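/- arXiv:math/0501485 — 11 statements merged into one kernel-verified Lean document; each statement's English description precedes it below -/
import Mathlib

section
/- Let (H, ⟨·,·⟩) be a real inner product space. For any a, b ∈ H and any x, y ∈ H \ {0}, one has (−‖a‖‖b‖ + ⟨a,b⟩)/2 ≤ ⟨x,a⟩⟨x,b⟩/‖x‖² + ⟨y,a⟩⟨y,b⟩/‖y‖² − 2·⟨x,a⟩⟨y,b⟩⟨x,y⟩/(‖x‖²‖y‖²) ≤ (‖a‖‖b‖ + ⟨a,b⟩)/2. -/
open RealInnerProductSpace

/-- The reflection of `a` in the hyperplane orthogonal to `x` has the same norm as `a`. -/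
lemma norm_sub_two_mul_inner_div_smul {H : Type*} [NormedAddCommGroup H] [InnerProductSpace ℝ H]
    (a : H) {x : H} (hx : x ≠ 0) : ‖a - (2 * (⟪x, a⟫ / ‖x‖ ^ 2)) • x‖ = ‖a‖ := by
  have hx' : ‖x‖ ≠ 0 := norm_ne_zero_iff.mpr hx
  rw [← sq_eq_sq₀ (norm_nonneg _) (norm_nonneg _), norm_sub_sq_real, norm_smul, mul_pow,
    Real.norm_eq_abs, sq_abs, real_inner_smul_right, real_inner_comm]
  field_simp
  ring

theorem precupanu_inequality {H : Type*} [NormedAddCommGroup H] [InnerProductSpace ℝ H]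
    (a b : H) (x y : H) (hx : x ≠ 0) (hy : y ≠ 0) :
    (-(‖a‖ * ‖b‖) + ⟪a, b⟫) / 2 ≤
      ⟪x, a⟫ * ⟪x, b⟫ / ‖x‖ ^ 2 + ⟪y, a⟫ * ⟪y, b⟫ / ‖y‖ ^ 2 -
        2 * (⟪x, a⟫ * ⟪y, b⟫ * ⟪x, y⟫ / (‖x‖ ^ 2 * ‖y‖ ^ 2)) ∧
    ⟪x, a⟫ * ⟪x, b⟫ / ‖x‖ ^ 2 + ⟪y, a⟫ * ⟪y, b⟫ / ‖y‖ ^ 2 -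
        2 * (⟪x, a⟫ * ⟪y, b⟫ * ⟪x, y⟫ / (‖x‖ ^ 2 * ‖y‖ ^ 2)) ≤
      (‖a‖ * ‖b‖ + ⟪a, b⟫) / 2 := by
  have hx' : ‖x‖ ≠ 0 := norm_ne_zero_iff.mpr hx
  have hy' : ‖y‖ ≠ 0 := norm_ne_zero_iff.mpr hy
  have key : ⟪x, a⟫ * ⟪x, b⟫ / ‖x‖ ^ 2 + ⟪y, a⟫ * ⟪y, b⟫ / ‖y‖ ^ 2 -
        2 * (⟪x, a⟫ * ⟪y, b⟫ * ⟪x, y⟫ / (‖x‖ ^ 2 * ‖y‖ ^ 2)) =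
      (⟪a, b⟫ - ⟪a - (2 * (⟪x, a⟫ / ‖x‖ ^ 2)) • x, b - (2 * (⟪y, b⟫ / ‖y‖ ^ 2)) • y⟫) / 2 := by
    simp only [inner_sub_left, inner_sub_right, real_inner_smul_left, real_inner_smul_right]
    rw [real_inner_comm y a]
    field_simp
    ring
  have hcs := abs_le.mp (abs_real_inner_le_norm
    (a - (2 * (⟪x, a⟫ / ‖x‖ ^ 2)) • x) (b - (2 * (⟪y, b⟫ / ‖y‖ ^ 2)) • y))
  rw [norm_sub_two_mul_inner_div_smul a hx, norm_sub_two_mul_inner_div_smul b hy] at hcs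
  rw [key]
  constructor <;> linarith [hcs.1, hcs.2]
end

section
/- Let (H, ⟨·,·⟩) be a real inner product space. For any a, b, x ∈ H, one has ((−‖a‖‖b‖ + ⟨a,b⟩)/2)·‖x‖² ≤ ⟨x,a⟩⟨x,b⟩ ≤ ((‖a‖‖b‖ + ⟨a,b⟩)/2)·‖x‖² (Richard's inequality). -/
open RealInnerProductSpace

theorem norm_two_inner_smul_sub_norm_sq_smul {H : Type*} [NormedAddCommGroup H]
    [InnerProductSpace ℝ H] (a x : H) :
    ‖(2 * inner ℝ x a) • x - (‖x‖ ^ 2) • a‖ = ‖x‖ ^ 2 * ‖a‖ := by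
  rw [← sq_eq_sq₀ (norm_nonneg _) (by positivity), norm_sub_sq_real, norm_smul, norm_smul,
    real_inner_smul_left, real_inner_smul_right, mul_pow, mul_pow, Real.norm_eq_abs,
    Real.norm_eq_abs, sq_abs, sq_abs]
  ring

theorem richard_inequality {H : Type*} [NormedAddCommGroup H] [InnerProductSpace ℝ H]
    (a b x : H) :
    (-(‖a‖ * ‖b‖) + ⟪a, b⟫) / 2 * ‖x‖ ^ 2 ≤ ⟪x, a⟫ * ⟪x, b⟫ ∧
    ⟪x, a⟫ * ⟪x, b⟫ ≤ (‖a‖ * ‖b‖ + ⟪a, b⟫) / 2 * ‖x‖ ^ 2 := by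
  have h := abs_real_inner_le_norm ((2 * inner ℝ x a) • x - (‖x‖ ^ 2) • a) b
  rw [norm_two_inner_smul_sub_norm_sq_smul, inner_sub_left, real_inner_smul_left,
    real_inner_smul_left, abs_le] at h
  constructor <;> linarith [h.1, h.2]
end

section
/- Let (H, ⟨·,·⟩) be a real inner product space. For any a ∈ H and any x, y ∈ H \ {0}, one has 0 ≤ ⟨x,a⟩²/‖x‖² + ⟨y,a⟩²/‖y‖² − 2·⟨x,a⟩⟨y,a⟩⟨x,y⟩/(‖x‖²‖y‖²) ≤ ‖a‖². -/
open RealInnerProductSpace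

theorem precupanu_a_eq_b {H : Type*} [NormedAddCommGroup H] [InnerProductSpace ℝ H]
    (a : H) (x y : H) (hx : x ≠ 0) (hy : y ≠ 0) :
    0 ≤ ⟪x, a⟫ ^ 2 / ‖x‖ ^ 2 + ⟪y, a⟫ ^ 2 / ‖y‖ ^ 2 -
        2 * (⟪x, a⟫ * ⟪y, a⟫ * ⟪x, y⟫ / (‖x‖ ^ 2 * ‖y‖ ^ 2)) ∧
    ⟪x, a⟫ ^ 2 / ‖x‖ ^ 2 + ⟪y, a⟫ ^ 2 / ‖y‖ ^ 2 -
        2 * (⟪x, a⟫ * ⟪y, a⟫ * ⟪x, y⟫ / (‖x‖ ^ 2 * ‖y‖ ^ 2)) ≤ ‖a‖ ^ 2 := by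
  have hx' : ‖x‖ ≠ 0 := norm_ne_zero_iff.mpr hx
  have hy' : ‖y‖ ≠ 0 := norm_ne_zero_iff.mpr hy
  -- With `p`, `q` the projections of `a` onto the lines through `x` and `y`, the middle term is
  -- `‖p - q‖ ^ 2`, and it differs from `‖a‖ ^ 2` by `‖a - p - q‖ ^ 2`.
  have h_diff : ‖(⟪x, a⟫ / ‖x‖ ^ 2) • x - (⟪y, a⟫ / ‖y‖ ^ 2) • y‖ ^ 2 =
      ⟪x, a⟫ ^ 2 / ‖x‖ ^ 2 + ⟪y, a⟫ ^ 2 / ‖y‖ ^ 2 -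
        2 * (⟪x, a⟫ * ⟪y, a⟫ * ⟪x, y⟫ / (‖x‖ ^ 2 * ‖y‖ ^ 2)) := by
    rw [← real_inner_self_eq_norm_sq (_ - _)]
    simp only [inner_sub_left, inner_sub_right, real_inner_smul_left, real_inner_smul_right,
      real_inner_self_eq_norm_sq, norm_smul, mul_pow, Real.norm_eq_abs, sq_abs,
      real_inner_comm x y]
    field_simp
    ring
  have h_compl : ‖a - (⟪x, a⟫ / ‖x‖ ^ 2) • x - (⟪y, a⟫ / ‖y‖ ^ 2) • y‖ ^ 2 =
      ‖a‖ ^ 2 - (⟪x, a⟫ ^ 2 / ‖x‖ ^ 2 + ⟪y, a⟫ ^ 2 / ‖y‖ ^ 2 -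
        2 * (⟪x, a⟫ * ⟪y, a⟫ * ⟪x, y⟫ / (‖x‖ ^ 2 * ‖y‖ ^ 2))) := by
    rw [← real_inner_self_eq_norm_sq (_ - _)]
    simp only [inner_sub_left, inner_sub_right, real_inner_smul_left, real_inner_smul_right,
      real_inner_self_eq_norm_sq, norm_smul, mul_pow, Real.norm_eq_abs, sq_abs,
      real_inner_comm x y, real_inner_comm x a, real_inner_comm y a]
    field_simp
    ring
  exact ⟨h_diff ▸ sq_nonneg _, sub_nonneg.mp (h_compl ▸ sq_nonneg _)⟩
end

section
/- Let (H, ⟨·,·⟩) be a real inner product space. For any a, x, y ∈ H \ {0}, one has ⟨x,y⟩/(‖x‖‖y‖) ≥ (1/2)·[⟨x,a⟩/(‖x‖‖a‖) + ⟨y,a⟩/(‖y‖‖a‖)]² − 3/2. -/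
open RealInnerProductSpace

/-- For unit vectors, `(⟪u, e⟫ + ⟪v, e⟫) ^ 2 ≤ ‖u + v‖ ^ 2 = 2 + 2 * ⟪u, v⟫`. -/
theorem sq_inner_add_inner_le_of_norm_eq_one {H : Type*} [NormedAddCommGroup H]
    [InnerProductSpace ℝ H] {e u v : H} (he : ‖e‖ = 1) (hu : ‖u‖ = 1) (hv : ‖v‖ = 1) :
    (⟪u, e⟫ + ⟪v, e⟫) ^ 2 ≤ 2 + 2 * ⟪u, v⟫ := by
  have h : |⟪u + v, e⟫| ≤ ‖u + v‖ := by simpa [he] using abs_real_inner_le_norm (u + v) e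
  have hsq : ⟪u + v, e⟫ ^ 2 ≤ ‖u + v‖ ^ 2 := sq_le_sq' (abs_le.mp h).1 (abs_le.mp h).2
  rw [inner_add_left, norm_add_sq_real, hu, hv] at hsq
  linarith

/-- The cosine of the angle is the inner product of the normalized vectors. -/
theorem inner_normalize_normalize {H : Type*} [NormedAddCommGroup H] [InnerProductSpace ℝ H]
    (x y : H) : ⟪‖x‖⁻¹ • x, ‖y‖⁻¹ • y⟫ = ⟪x, y⟫ / (‖x‖ * ‖y‖) := by
  rw [real_inner_smul_left, real_inner_smul_right, div_eq_mul_inv, mul_inv]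
  ring

theorem precupanu_cos_inequality {H : Type*} [NormedAddCommGroup H] [InnerProductSpace ℝ H]
    (a x y : H) (ha : a ≠ 0) (hx : x ≠ 0) (hy : y ≠ 0) :
    ⟪x, y⟫ / (‖x‖ * ‖y‖) ≥
      (1 / 2) * (⟪x, a⟫ / (‖x‖ * ‖a‖) + ⟪y, a⟫ / (‖y‖ * ‖a‖)) ^ 2 - 3 / 2 := by
  have norm_normalize {z : H} (hz : z ≠ 0) : ‖‖z‖⁻¹ • z‖ = 1 := by
    rw [norm_smul, norm_inv, norm_norm, inv_mul_cancel₀ (norm_ne_zero_iff.mpr hz)]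
  have h := sq_inner_add_inner_le_of_norm_eq_one
    (norm_normalize ha) (norm_normalize hx) (norm_normalize hy)
  simp only [inner_normalize_normalize] at h
  linarith
end

section
/- Let (H, ⟨·,·⟩) be a real inner product space, let ε ∈ (0, 1], and let x, y, z ∈ H with x ≠ 0. If |⟨x,y⟩| ≥ (1−ε)‖x‖‖y‖ and |⟨x,z⟩| ≥ (1−ε)‖x‖‖z‖, then |⟨y,z⟩| ≥ max{1 − ε − √(2ε), 1 − 4ε, 0}·‖y‖‖z‖ (Moore's inequality). -/
open RealInnerProductSpace

/-- Cauchy–Schwarz for the components of `y` and `z` orthogonal to `x`. -/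
theorem sq_inner_orthogonal_component_le {H : Type*} [NormedAddCommGroup H]
    [InnerProductSpace ℝ H] (x y z : H) (hx : x ≠ 0) :
    (‖x‖ ^ 2 * ⟪y, z⟫ - ⟪x, y⟫ * ⟪x, z⟫) ^ 2 ≤
      ((‖x‖ * ‖y‖) ^ 2 - ⟪x, y⟫ ^ 2) * ((‖x‖ * ‖z‖) ^ 2 - ⟪x, z⟫ ^ 2) := by
  have hn : 0 < ‖x‖ := norm_pos_iff.mpr hx
  have key : ∀ v w : H, ⟪‖x‖ ^ 2 • v - ⟪x, v⟫ • x, ‖x‖ ^ 2 • w - ⟪x, w⟫ • x⟫ =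
      ‖x‖ ^ 2 * (‖x‖ ^ 2 * ⟪v, w⟫ - ⟪x, v⟫ * ⟪x, w⟫) := by
    intro v w
    simp only [inner_sub_left, inner_sub_right, real_inner_smul_left, real_inner_smul_right,
      real_inner_self_eq_norm_sq, real_inner_comm x v]
    ring
  have h := real_inner_mul_inner_self_le (‖x‖ ^ 2 • y - ⟪x, y⟫ • x) (‖x‖ ^ 2 • z - ⟪x, z⟫ • x)
  rw [key, key, key, real_inner_self_eq_norm_sq, real_inner_self_eq_norm_sq] at h
  refine le_of_mul_le_mul_left ?_ (pow_pos hn 4)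
  linarith

/-- If `x` makes a small angle with the lines through `y` and `z`, then so do `y` and `z` with
each other: this is the double-angle bound `cos (2 * θ) = 2 * cos θ ^ 2 - 1`. -/
theorem two_mul_sq_sub_one_mul_le_abs_inner {H : Type*} [NormedAddCommGroup H]
    [InnerProductSpace ℝ H] (c : ℝ) (hc : 0 ≤ c) (x y z : H) (hx : x ≠ 0)
    (hy : c * ‖x‖ * ‖y‖ ≤ |⟪x, y⟫|) (hz : c * ‖x‖ * ‖z‖ ≤ |⟪x, z⟫|) :
    (2 * c ^ 2 - 1) * (‖y‖ * ‖z‖) ≤ |⟪y, z⟫| := by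
  have hn : 0 < ‖x‖ := norm_pos_iff.mpr hx
  have sq_sub_le : ∀ w : H, c * ‖x‖ * ‖w‖ ≤ |⟪x, w⟫| →
      (‖x‖ * ‖w‖) ^ 2 - ⟪x, w⟫ ^ 2 ≤ (1 - c ^ 2) * (‖x‖ * ‖w‖) ^ 2 := by
    intro w hw
    have h := pow_le_pow_left₀ (by positivity) hw 2
    rw [sq_abs] at h
    linarith
  have sq_sub_nonneg : ∀ w : H, 0 ≤ (‖x‖ * ‖w‖) ^ 2 - ⟪x, w⟫ ^ 2 := by
    intro w
    have h := pow_le_pow_left₀ (abs_nonneg _) (abs_real_inner_le_norm x w) 2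
    rw [sq_abs] at h
    linarith
  have hprod : c ^ 2 * (‖x‖ ^ 2 * (‖y‖ * ‖z‖)) ≤ |⟪x, y⟫ * ⟪x, z⟫| := by
    rw [abs_mul]
    have h := mul_le_mul hy hz (by positivity) (abs_nonneg _)
    linarith
  have hsq : (‖x‖ ^ 2 * ⟪y, z⟫ - ⟪x, y⟫ * ⟪x, z⟫) ^ 2 ≤
      ((1 - c ^ 2) * (‖x‖ ^ 2 * (‖y‖ * ‖z‖))) ^ 2 := by
    refine (sq_inner_orthogonal_component_le x y z hx).trans ?_
    have h := mul_le_mul (sq_sub_le y hy) (sq_sub_le z hz) (sq_sub_nonneg z)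
      ((sq_sub_nonneg y).trans (sq_sub_le y hy))
    linarith
  have hdiff : |‖x‖ ^ 2 * ⟪y, z⟫ - ⟪x, y⟫ * ⟪x, z⟫| ≤
      (1 - c ^ 2) * (‖x‖ ^ 2 * (‖y‖ * ‖z‖)) := by
    rcases eq_or_ne (‖y‖ * ‖z‖) 0 with h0 | h0
    · rw [h0] at hsq ⊢
      simpa using hsq
    · refine abs_le_of_sq_le_sq hsq (mul_nonneg ?_ (by positivity))
      have hy0 : 0 < (‖x‖ * ‖y‖) ^ 2 :=
        pow_pos (mul_pos hn ((norm_nonneg y).lt_of_ne' (left_ne_zero_of_mul h0))) 2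
      exact nonneg_of_mul_nonneg_left ((sq_sub_nonneg y).trans (sq_sub_le y hy)) hy0
  have htri := abs_sub_abs_le_abs_sub (⟪x, y⟫ * ⟪x, z⟫) (‖x‖ ^ 2 * ⟪y, z⟫)
  rw [abs_sub_comm, abs_mul (‖x‖ ^ 2), abs_of_pos (pow_pos hn 2)] at htri
  refine le_of_mul_le_mul_left ?_ (pow_pos hn 2)
  linarith

theorem one_sub_sub_sqrt_le (ε : ℝ) (hε : 0 ≤ ε) :
    1 - ε - Real.sqrt (2 * ε) ≤ 2 * (1 - ε) ^ 2 - 1 := by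
  have ht := Real.sqrt_nonneg (2 * ε)
  have hsq := Real.sq_sqrt (show 0 ≤ 2 * ε by linarith)
  generalize Real.sqrt (2 * ε) = t at *
  obtain rfl : ε = t ^ 2 / 2 := by linarith
  have h : 0 ≤ t / 2 * (t - 1) ^ 2 * (t + 2) := by positivity
  linarith

theorem moore_inequality {H : Type*} [NormedAddCommGroup H] [InnerProductSpace ℝ H]
    (ε : ℝ) (hε : ε ∈ Set.Ioc (0 : ℝ) 1) (x y z : H) (hx : x ≠ 0)
    (h1 : |⟪x, y⟫| ≥ (1 - ε) * ‖x‖ * ‖y‖)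
    (h2 : |⟪x, z⟫| ≥ (1 - ε) * ‖x‖ * ‖z‖) :
    |⟪y, z⟫| ≥ max (1 - ε - Real.sqrt (2 * ε)) (max (1 - 4 * ε) 0) * (‖y‖ * ‖z‖) := by
  have hmain := two_mul_sq_sub_one_mul_le_abs_inner (1 - ε) (sub_nonneg.mpr hε.2) x y z hx h1 h2
  have hyz : 0 ≤ ‖y‖ * ‖z‖ := by positivity
  rw [max_mul_of_nonneg _ _ hyz, max_mul_of_nonneg _ _ hyz, zero_mul]
  refine max_le ?_ (max_le ?_ (abs_nonneg _))
  · exact (mul_le_mul_of_nonneg_right (one_sub_sub_sqrt_le ε hε.1.le) hyz).trans hmain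
  · refine (mul_le_mul_of_nonneg_right ?_ hyz).trans hmain
    linarith [sq_nonneg ε]
end

section
/- Let (H, ⟨·,·⟩) be a real inner product space, let a, b, x ∈ H with x ≠ 0, and let 0 < ε₁ < ε₂ be real numbers. If ε₁‖x‖‖a‖ ≤ ⟨x,a⟩ ≤ ε₂‖x‖‖a‖ and ε₁‖x‖‖b‖ ≤ ⟨x,b⟩ ≤ ε₂‖x‖‖b‖, then (2ε₁² − 1)‖a‖‖b‖ ≤ ⟨a,b⟩ ≤ (2ε₁² + 1)‖a‖‖b‖. -/
open RealInnerProductSpace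

/-- Precupanu's inequality: Cauchy–Schwarz applied to the reflection of `a` in the line
spanned by `x`. -/
theorem two_mul_inner_mul_inner_le {H : Type*} [NormedAddCommGroup H] [InnerProductSpace ℝ H]
    (a b x : H) :
    2 * (⟪x, a⟫ * ⟪x, b⟫) ≤ ‖x‖ ^ 2 * (⟪a, b⟫ + ‖a‖ * ‖b‖) := by
  have hnorm : ‖(2 * ⟪x, a⟫) • x - (‖x‖ ^ 2) • a‖ = ‖x‖ ^ 2 * ‖a‖ := by
    rw [← sq_eq_sq₀ (norm_nonneg _) (by positivity), norm_sub_sq_real, norm_smul, norm_smul,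
      real_inner_smul_left, real_inner_smul_right, mul_pow, mul_pow, Real.norm_eq_abs,
      Real.norm_eq_abs, sq_abs, sq_abs]
    ring
  have hcs := real_inner_le_norm ((2 * ⟪x, a⟫) • x - (‖x‖ ^ 2) • a) b
  rw [hnorm, inner_sub_left, real_inner_smul_left, real_inner_smul_left] at hcs
  linarith

theorem precupanu_moore_type {H : Type*} [NormedAddCommGroup H] [InnerProductSpace ℝ H]
    (a b x : H) (hx : x ≠ 0) (ε₁ ε₂ : ℝ) (hε₁ : 0 < ε₁) (hε₁₂ : ε₁ < ε₂)
    (ha1 : ε₁ * ‖x‖ * ‖a‖ ≤ ⟪x, a⟫) (ha2 : ⟪x, a⟫ ≤ ε₂ * ‖x‖ * ‖a‖)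
    (hb1 : ε₁ * ‖x‖ * ‖b‖ ≤ ⟪x, b⟫) (hb2 : ⟪x, b⟫ ≤ ε₂ * ‖x‖ * ‖b‖) :
    (2 * ε₁ ^ 2 - 1) * (‖a‖ * ‖b‖) ≤ ⟪a, b⟫ ∧
      ⟪a, b⟫ ≤ (2 * ε₁ ^ 2 + 1) * (‖a‖ * ‖b‖) := by
  constructor
  · have hprod : (ε₁ * ‖x‖ * ‖a‖) * (ε₁ * ‖x‖ * ‖b‖) ≤ ⟪x, a⟫ * ⟪x, b⟫ :=
      mul_le_mul ha1 hb1 (by positivity) (le_trans (by positivity) ha1)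
    have hx2 : 0 < ‖x‖ ^ 2 := pow_pos (norm_pos_iff.mpr hx) 2
    have hle := two_mul_inner_mul_inner_le a b x
    refine le_of_mul_le_mul_left ?_ hx2
    linarith
  · have hcs := real_inner_le_norm a b
    have hnonneg : 0 ≤ 2 * ε₁ ^ 2 * (‖a‖ * ‖b‖) := by positivity
    linarith
end

section
/- Let (H, ⟨·,·⟩) be a complex inner product space. For any x, a, b ∈ H, one has |⟨x,a⟩⟨x,b⟩| ≤ ((‖a‖‖b‖ + |⟨a,b⟩|)/2)·‖x‖² (Buzano's inequality). -/
open ComplexInnerProductSpace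

/-- Up to the factor `‖x‖ ^ 2`, the vector on the left is the reflection of `a` in the line
spanned by `x`. -/
theorem norm_two_mul_inner_smul_sub {𝕜 E : Type*} [RCLike 𝕜] [NormedAddCommGroup E]
    [InnerProductSpace 𝕜 E] (x a : E) :
    ‖(2 * inner 𝕜 x a) • x - ((‖x‖ ^ 2 : ℝ) : 𝕜) • a‖ = ‖x‖ ^ 2 * ‖a‖ := by
  have h : RCLike.re (inner 𝕜 ((2 * inner 𝕜 x a) • x) (((‖x‖ ^ 2 : ℝ) : 𝕜) • a))
      = 2 * ‖x‖ ^ 2 * ‖inner 𝕜 x a‖ ^ 2 := by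
    have hc : inner 𝕜 ((2 * inner 𝕜 x a) • x) (((‖x‖ ^ 2 : ℝ) : 𝕜) • a)
        = ((2 * ‖x‖ ^ 2 * ‖inner 𝕜 x a‖ ^ 2 : ℝ) : 𝕜) := by
      rw [inner_smul_left, inner_smul_right, map_mul, map_ofNat]
      push_cast
      rw [← RCLike.conj_mul]
      ring
    rw [hc, RCLike.ofReal_re]
  rw [← sq_eq_sq₀ (norm_nonneg _) (by positivity), norm_sub_sq (𝕜 := 𝕜), h, norm_smul, norm_smul,
    norm_mul, RCLike.norm_two, RCLike.norm_of_nonneg (sq_nonneg ‖x‖)]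
  ring

theorem buzano_inequality {H : Type*} [NormedAddCommGroup H] [InnerProductSpace ℂ H]
    (x a b : H) :
    ‖⟪x, a⟫ * ⟪x, b⟫‖ ≤ (‖a‖ * ‖b‖ + ‖⟪a, b⟫‖) / 2 * ‖x‖ ^ 2 := by
  set y : H := (2 * ⟪x, a⟫) • x - ((‖x‖ ^ 2 : ℝ) : ℂ) • a
  have hy : ‖y‖ = ‖x‖ ^ 2 * ‖a‖ := norm_two_mul_inner_smul_sub x a
  have hinner : ⟪(2 * ⟪x, a⟫) • x, b⟫ = ⟪y, b⟫ + ((‖x‖ ^ 2 : ℝ) : ℂ) * ⟪a, b⟫ := by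
    simp only [y, inner_sub_left, inner_smul_left _ _ ((‖x‖ ^ 2 : ℝ) : ℂ), Complex.conj_ofReal]
    ring
  have hle : 2 * ‖⟪x, a⟫ * ⟪x, b⟫‖ ≤ ‖x‖ ^ 2 * ‖a‖ * ‖b‖ + ‖x‖ ^ 2 * ‖⟪a, b⟫‖ :=
    calc 2 * ‖⟪x, a⟫ * ⟪x, b⟫‖ = ‖⟪(2 * ⟪x, a⟫) • x, b⟫‖ := by
          rw [inner_smul_left, norm_mul, norm_mul, RCLike.norm_conj, norm_mul, Complex.norm_two,
            mul_assoc]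
      _ ≤ ‖⟪y, b⟫‖ + ‖((‖x‖ ^ 2 : ℝ) : ℂ) * ⟪a, b⟫‖ := hinner ▸ norm_add_le _ _
      _ ≤ ‖x‖ ^ 2 * ‖a‖ * ‖b‖ + ‖x‖ ^ 2 * ‖⟪a, b⟫‖ := by
          rw [norm_mul, Complex.norm_of_nonneg (sq_nonneg ‖x‖), ← hy]
          gcongr
          exact norm_inner_le_norm y b
  linarith
end

section
/- Let (H, ⟨·,·⟩) be a complex inner product space, let ε ∈ (0, 1], and let x, a, b ∈ H with x ≠ 0. If |⟨x,a⟩| ≥ (1−ε)‖x‖‖a‖ and |⟨x,b⟩| ≥ (1−ε)‖x‖‖b‖, then |⟨a,b⟩| ≥ (1 − 4ε + 2ε²)‖a‖‖b‖. -/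
open ComplexInnerProductSpace

/-- Precupanu's inequality: the reflection in the line spanned by `x` is an isometry, so
Cauchy-Schwarz applies to the reflection of `a` and the vector `b`. -/
lemma two_mul_norm_inner_mul_norm_inner_le {H : Type*} [NormedAddCommGroup H]
    [InnerProductSpace ℂ H] {x : H} (hx : x ≠ 0) (a b : H) :
    2 * (‖⟪x, a⟫‖ * ‖⟪x, b⟫‖) / ‖x‖ ^ 2 ≤ ‖⟪a, b⟫‖ + ‖a‖ * ‖b‖ := by
  have hx0 : ‖x‖ ≠ 0 := norm_ne_zero_iff.mpr hx
  have hcs := norm_inner_le_norm (𝕜 := ℂ) ((ℂ ∙ x).reflection a) b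
  rw [LinearIsometryEquiv.norm_map, Submodule.reflection_singleton_apply, inner_sub_left,
    two_smul, inner_add_left, inner_smul_left, ← two_mul] at hcs
  have htri := norm_sub_norm_le (2 * ((starRingEnd ℂ) (⟪x, a⟫ / (‖x‖ : ℂ) ^ 2) * ⟪x, b⟫)) ⟪a, b⟫
  have hnorm : ‖2 * ((starRingEnd ℂ) (⟪x, a⟫ / (‖x‖ : ℂ) ^ 2) * ⟪x, b⟫)‖ =
      2 * (‖⟪x, a⟫‖ * ‖⟪x, b⟫‖) / ‖x‖ ^ 2 := by
    simp only [norm_mul, RCLike.norm_conj, norm_div, norm_pow, Complex.norm_real, norm_norm,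
      Complex.norm_ofNat]
    field_simp
  rw [hnorm] at htri
  have := htri.trans hcs
  linarith

theorem precupanu_complex_moore_type {H : Type*} [NormedAddCommGroup H]
    [InnerProductSpace ℂ H] (ε : ℝ) (hε : ε ∈ Set.Ioc (0 : ℝ) 1)
    (x a b : H) (hx : x ≠ 0)
    (h1 : ‖⟪x, a⟫‖ ≥ (1 - ε) * ‖x‖ * ‖a‖)
    (h2 : ‖⟪x, b⟫‖ ≥ (1 - ε) * ‖x‖ * ‖b‖) :
    ‖⟪a, b⟫‖ ≥ (1 - 4 * ε + 2 * ε ^ 2) * (‖a‖ * ‖b‖) := by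
  have hx0 : 0 < ‖x‖ := norm_pos_iff.mpr hx
  have hε1 : 0 ≤ 1 - ε := sub_nonneg.mpr hε.2
  have hprod : (1 - ε) * ‖x‖ * ‖a‖ * ((1 - ε) * ‖x‖ * ‖b‖) ≤ ‖⟪x, a⟫‖ * ‖⟪x, b⟫‖ :=
    mul_le_mul h1 h2 (by positivity) (norm_nonneg _)
  have hlower : 2 * (1 - ε) ^ 2 * (‖a‖ * ‖b‖) ≤ 2 * (‖⟪x, a⟫‖ * ‖⟪x, b⟫‖) / ‖x‖ ^ 2 := by
    rw [le_div_iff₀ (by positivity)]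
    linarith
  linarith [two_mul_norm_inner_mul_norm_inner_le hx a b]
end

section
/- Let (H, ⟨·,·⟩) be a real inner product space and let a, b, x ∈ H \ {0}. If there exists μ₁ ∈ [0, 1] such that μ₁‖a‖‖b‖ ≤ ⟨x,a⟩⟨x,b⟩/‖x‖², then (2μ₁ − 1)‖a‖‖b‖ ≤ ⟨a,b⟩. -/
open RealInnerProductSpace

/-- Richard's inequality (the upper half), from the Cauchy-Schwarz inequality applied to the
reflection of `a` in the line spanned by `x`. -/
theorem two_mul_inner_mul_inner_div_sub_inner_le {H : Type*} [NormedAddCommGroup H]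
    [InnerProductSpace ℝ H] (a b x : H) :
    2 * (⟪x, a⟫ * ⟪x, b⟫ / ‖x‖ ^ 2) - ⟪a, b⟫ ≤ ‖a‖ * ‖b‖ := by
  have key := real_inner_le_norm ((ℝ ∙ x).reflection a) b
  rw [LinearIsometryEquiv.norm_map, Submodule.reflection_singleton_apply, inner_sub_left,
    ← Nat.cast_smul_eq_nsmul ℝ, inner_smul_left, inner_smul_left] at key
  convert key using 2
  simp
  ring

theorem precupanu_mu_lower_bound {H : Type*} [NormedAddCommGroup H] [InnerProductSpace ℝ H]
    (a b x : H) (ha : a ≠ 0) (hb : b ≠ 0) (hx : x ≠ 0)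
    (μ₁ : ℝ) (hμ₁ : μ₁ ∈ Set.Icc (0 : ℝ) 1)
    (h : μ₁ * (‖a‖ * ‖b‖) ≤ ⟪x, a⟫ * ⟪x, b⟫ / ‖x‖ ^ 2) :
    (2 * μ₁ - 1) * (‖a‖ * ‖b‖) ≤ ⟪a, b⟫ := by
  linarith [two_mul_inner_mul_inner_div_sub_inner_le a b x]
end

section
/- Let (H, ⟨·,·⟩) be a real inner product space and let a, b, x ∈ H \ {0}. If there exists μ₂ ∈ [−1, 0] such that ⟨x,a⟩⟨x,b⟩/‖x‖² ≤ μ₂‖a‖‖b‖, then ⟨a,b⟩ ≤ (2μ₂ + 1)‖a‖‖b‖. -/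
open RealInnerProductSpace

/-- Precupanu's inequality (lower bound), obtained by applying Cauchy-Schwarz to `b` and the
reflection of `a` in the line spanned by `x`. -/
theorem neg_norm_mul_norm_le_two_mul_inner_mul_inner_div_sub_inner {H : Type*}
    [NormedAddCommGroup H] [InnerProductSpace ℝ H] (a b : H) {x : H} (hx : x ≠ 0) :
    -(‖a‖ * ‖b‖) ≤ 2 * (⟪x, a⟫ * ⟪x, b⟫ / ‖x‖ ^ 2) - ⟪a, b⟫ := by
  have hx' : ‖x‖ ≠ 0 := norm_ne_zero_iff.mpr hx
  have hnorm : ‖(2 * ⟪x, a⟫ / ‖x‖ ^ 2) • x - a‖ = ‖a‖ := by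
    rw [← sq_eq_sq₀ (norm_nonneg _) (norm_nonneg _), norm_sub_sq_real, norm_smul,
      real_inner_smul_left, mul_pow, Real.norm_eq_abs, sq_abs]
    field_simp
    ring
  have hinner : ⟪(2 * ⟪x, a⟫ / ‖x‖ ^ 2) • x - a, b⟫ =
      2 * (⟪x, a⟫ * ⟪x, b⟫ / ‖x‖ ^ 2) - ⟪a, b⟫ := by
    rw [inner_sub_left, real_inner_smul_left]
    ring
  rw [← hinner, ← hnorm]
  exact neg_le_of_abs_le (abs_real_inner_le_norm _ _)

theorem precupanu_mu_upper_bound {H : Type*} [NormedAddCommGroup H] [InnerProductSpace ℝ H]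
    (a b x : H) (ha : a ≠ 0) (hb : b ≠ 0) (hx : x ≠ 0)
    (μ₂ : ℝ) (hμ₂ : μ₂ ∈ Set.Icc (-1 : ℝ) 0)
    (h : ⟪x, a⟫ * ⟪x, b⟫ / ‖x‖ ^ 2 ≤ μ₂ * (‖a‖ * ‖b‖)) :
    ⟪a, b⟫ ≤ (2 * μ₂ + 1) * (‖a‖ * ‖b‖) := by
  linarith [neg_norm_mul_norm_le_two_mul_inner_mul_inner_div_sub_inner a b hx]
end

section
/- Let (H, ⟨·,·⟩) be a real inner product space and let {e_i}_{i∈I} and {f_j}_{j∈J} be two finite orthonormal families of vectors in H. Then for any x, y ∈ H one has (1/2)[⟨x,y⟩ − ‖x‖‖y‖] ≤ Σ_{i∈I} ⟨x,e_i⟩⟨y,e_i⟩ + Σ_{j∈J} ⟨x,f_j⟩⟨y,f_j⟩ − 2·Σ_{i∈I, j∈J} ⟨x,e_i⟩⟨y,f_j⟩⟨e_i,f_j⟩ ≤ (1/2)[⟨x,y⟩ + ‖x‖‖y‖]. -/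
open RealInnerProductSpace

/-- Reflection in the span of a finite orthonormal family preserves the norm. -/
theorem Orthonormal.norm_two_smul_sum_inner_sub {H : Type*} [NormedAddCommGroup H]
    [InnerProductSpace ℝ H] {I : Type*} [Fintype I] {e : I → H} (he : Orthonormal ℝ e) (x : H) :
    ‖(2 : ℝ) • (∑ i, ⟪x, e i⟫ • e i) - x‖ = ‖x‖ := by
  have hself : ⟪∑ i, ⟪x, e i⟫ • e i, ∑ i, ⟪x, e i⟫ • e i⟫ = ∑ i, ⟪x, e i⟫ * ⟪x, e i⟫ := by
    rw [he.inner_sum]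
    simp
  have hx : ⟪∑ i, ⟪x, e i⟫ • e i, x⟫ = ∑ i, ⟪x, e i⟫ * ⟪x, e i⟫ := by
    simp only [sum_inner, real_inner_smul_left]
    exact Finset.sum_congr rfl fun i _ => by rw [real_inner_comm]
  rw [← sq_eq_sq₀ (norm_nonneg _) (norm_nonneg _), norm_sub_sq_real, norm_smul, mul_pow,
    ← real_inner_self_eq_norm_sq (∑ i, ⟪x, e i⟫ • e i), real_inner_smul_left, hself, hx]
  norm_num
  ring

theorem precupanu_orthonormal_real {H : Type*} [NormedAddCommGroup H] [InnerProductSpace ℝ H]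
    {I J : Type*} [Fintype I] [Fintype J]
    (e : I → H) (f : J → H) (he : Orthonormal ℝ e) (hf : Orthonormal ℝ f)
    (x y : H) :
    (1 / 2) * (⟪x, y⟫ - ‖x‖ * ‖y‖) ≤
      (∑ i, ⟪x, e i⟫ * ⟪y, e i⟫) + (∑ j, ⟪x, f j⟫ * ⟪y, f j⟫) -
        2 * ∑ i, ∑ j, ⟪x, e i⟫ * ⟪y, f j⟫ * ⟪e i, f j⟫ ∧
    (∑ i, ⟪x, e i⟫ * ⟪y, e i⟫) + (∑ j, ⟪x, f j⟫ * ⟪y, f j⟫) -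
        2 * ∑ i, ∑ j, ⟪x, e i⟫ * ⟪y, f j⟫ * ⟪e i, f j⟫ ≤
      (1 / 2) * (⟪x, y⟫ + ‖x‖ * ‖y‖) := by
  have hx : ⟪∑ i, ⟪x, e i⟫ • e i, y⟫ = ∑ i, ⟪x, e i⟫ * ⟪y, e i⟫ := by
    simp only [sum_inner, real_inner_smul_left]
    exact Finset.sum_congr rfl fun i _ => by rw [real_inner_comm y]
  have hy : ⟪x, ∑ j, ⟪y, f j⟫ • f j⟫ = ∑ j, ⟪x, f j⟫ * ⟪y, f j⟫ := by
    simp [inner_sum, real_inner_smul_right, mul_comm]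
  have hxy : ⟪∑ i, ⟪x, e i⟫ • e i, ∑ j, ⟪y, f j⟫ • f j⟫ =
      ∑ i, ∑ j, ⟪x, e i⟫ * ⟪y, f j⟫ * ⟪e i, f j⟫ := by
    simp only [sum_inner, real_inner_smul_left, inner_sum, real_inner_smul_right]
    rw [Finset.sum_comm]
    exact Finset.sum_congr rfl fun i _ => Finset.sum_congr rfl fun j _ => by ring
  have h := abs_real_inner_le_norm ((2 : ℝ) • (∑ i, ⟪x, e i⟫ • e i) - x)
    ((2 : ℝ) • (∑ j, ⟪y, f j⟫ • f j) - y)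
  rw [he.norm_two_smul_sum_inner_sub, hf.norm_two_smul_sum_inner_sub, inner_sub_left,
    inner_sub_right, inner_sub_right, real_inner_smul_left, real_inner_smul_left,
    real_inner_smul_right, real_inner_smul_right, hx, hy, hxy, abs_le] at h
  constructor <;> linarith [h.1, h.2]
end
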